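/- arXiv:1410.1442 — 4 statements merged into one kernel-verified Lean document; each statement's English description precedes it below -/
import Mathlib

section
/- Let k be a field, let A be an associative unital k-algebra, and let I be a left ideal of A such that the quotient left A-module A/I has dimension n as a k-vector space. Then I is a two-sided ideal of A if and only if the k-vector space End_A(A/I) of A-module endomorphisms of A/I has dimension n over k. -/
/-- Evaluation of an endomorphism of the cyclic module `A ⧸ I` at the class of `1`. -/
def endQuotientEval (k : Type*) [Field k] {A : Type*} [Ring A] [Algebra k A]
    (I : Submodule A A) : Module.End A (A ⧸ I) →ₗ[k] A ⧸ I where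
  toFun f := f (I.mkQ 1)
  map_add' _ _ := rfl
  map_smul' _ _ := rfl

lemma endQuotientEval_injective (k : Type*) [Field k] {A : Type*} [Ring A] [Algebra k A]
    (I : Submodule A A) : Function.Injective (endQuotientEval k I) := by
  intro f g h
  have h1 : f (I.mkQ 1) = g (I.mkQ 1) := h
  refine Submodule.linearMap_qext I (LinearMap.ext_ring ?_)
  simpa using h1

lemma endQuotientEval_surjective_iff (k : Type*) [Field k] {A : Type*} [Ring A] [Algebra k A]
    (I : Submodule A A) :
    Function.Surjective (endQuotientEval k I) ↔ ∀ x ∈ I, ∀ a : A, x * a ∈ I := by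
  constructor
  · intro h x hx a
    obtain ⟨f, hf⟩ := h (I.mkQ a)
    have hf : f (I.mkQ 1) = I.mkQ a := hf
    have hx0 : x • I.mkQ (1 : A) = 0 := by
      rw [← map_smul, smul_eq_mul, mul_one]
      exact (Submodule.Quotient.mk_eq_zero I).2 hx
    have hxa : I.mkQ (x * a) = 0 := by
      rw [← smul_eq_mul, map_smul, ← hf, ← map_smul, hx0, map_zero]
    exact (Submodule.Quotient.mk_eq_zero I).1 hxa
  · intro h y
    obtain ⟨a, rfl⟩ := I.mkQ_surjective y
    refine ⟨I.liftQ (LinearMap.toSpanSingleton A (A ⧸ I) (I.mkQ a)) fun x hx => ?_, ?_⟩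
    · rw [LinearMap.mem_ker, LinearMap.toSpanSingleton_apply, ← map_smul]
      exact (Submodule.Quotient.mk_eq_zero I).2 (h x hx a)
    · simp [endQuotientEval]

/-- For a left ideal `I` of a `k`-algebra `A` with `dim_k (A ⧸ I) = n`,
`I` is two-sided iff `dim_k End_A(A ⧸ I) = n`. -/
theorem stmt0 (k : Type*) [Field k] (A : Type*) [Ring A] [Algebra k A]
    (n : ℕ) (I : Submodule A A)
    [FiniteDimensional k (A ⧸ I)] (hdim : Module.finrank k (A ⧸ I) = n) :
    (∀ x ∈ I, ∀ a : A, x * a ∈ I) ↔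
      Module.finrank k (Module.End A (A ⧸ I)) = n := by
  have hinj := endQuotientEval_injective k I
  have : FiniteDimensional k (Module.End A (A ⧸ I)) :=
    FiniteDimensional.of_injective (endQuotientEval k I) hinj
  rw [← endQuotientEval_surjective_iff k I, ← hdim]
  constructor
  · intro hsurj
    exact (LinearEquiv.ofBijective (endQuotientEval k I) ⟨hinj, hsurj⟩).finrank_eq
  · intro h
    exact (LinearMap.injective_iff_surjective_of_finrank_eq_finrank h).1 hinj
end

section
/- Let k be a field, let A be an associative unital k-algebra, and let n ≥ 1. Then there exist a commutative k-algebra V_n(A) and a k-algebra homomorphism π_A : A → Mat_n(V_n(A)) such that for every commutative k-algebra B, the map sending a k-algebra homomorphism φ : V_n(A) → B to the composite Mat_n(φ) ∘ π_A is a bijection from the set of k-algebra homomorphisms V_n(A) → B onto the set of k-algebra homomorphisms A → Mat_n(B). -/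
universe u

namespace RepresentationRing

variable (k A m : Type*) [CommRing k] [Ring A] [Algebra k A]

/-- The matrix of indeterminates attached to `a : A`. -/
noncomputable def genericMatrix (a : A) : Matrix m m (MvPolynomial (A × m × m) k) :=
  Matrix.of fun i j => MvPolynomial.X (a, i, j)

variable [Fintype m] [DecidableEq m]

/-- The matrices whose entries must vanish for `genericMatrix` to be an algebra homomorphism. -/
inductive Relator : Matrix m m (MvPolynomial (A × m × m) k) → Prop
  | add (a b : A) :
      Relator (genericMatrix k A m (a + b) - (genericMatrix k A m a + genericMatrix k A m b))
  | mul (a b : A) :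
      Relator (genericMatrix k A m (a * b) - genericMatrix k A m a * genericMatrix k A m b)
  | algebraMap (r : k) :
      Relator (genericMatrix k A m (algebraMap k A r) - algebraMap k _ r)

/-- The ideal generated by the entries of all the relators. -/
noncomputable def relationIdeal : Ideal (MvPolynomial (A × m × m) k) :=
  Ideal.span {p | ∃ M, Relator k A m M ∧ ∃ i j, M i j = p}

end RepresentationRing

/-- The coordinate ring of the scheme of representations of `A` by matrices indexed by `m`. -/
abbrev RepresentationRing (k A m : Type*) [CommRing k] [Ring A] [Algebra k A]
    [Fintype m] [DecidableEq m] : Type _ :=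
  MvPolynomial (A × m × m) k ⧸ RepresentationRing.relationIdeal k A m

namespace RepresentationRing

variable (k A m : Type*) [CommRing k] [Ring A] [Algebra k A] [Fintype m] [DecidableEq m]

/-- The quotient map from the polynomial ring, applied entrywise. -/
noncomputable def mkMatrix :
    Matrix m m (MvPolynomial (A × m × m) k) →ₐ[k] Matrix m m (RepresentationRing k A m) :=
  (Ideal.Quotient.mkₐ k (relationIdeal k A m)).mapMatrix

variable {k A m}

theorem Relator.mkMatrix_eq_zero {M : Matrix m m (MvPolynomial (A × m × m) k)}
    (hM : Relator k A m M) : mkMatrix k A m M = 0 := by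
  ext i j
  exact Ideal.Quotient.eq_zero_iff_mem.2 (Ideal.subset_span ⟨M, hM, i, j, rfl⟩)

theorem mkMatrix_genericMatrix_algebraMap (r : k) :
    mkMatrix k A m (genericMatrix k A m (algebraMap k A r)) = algebraMap k _ r := by
  simpa [sub_eq_zero] using (Relator.algebraMap (A := A) (m := m) r).mkMatrix_eq_zero

variable (k A m) in
/-- The universal representation of `A` by matrices indexed by `m`. -/
noncomputable def universal : A →ₐ[k] Matrix m m (RepresentationRing k A m) where
  toFun a := mkMatrix k A m (genericMatrix k A m a)
  map_one' := by simpa using mkMatrix_genericMatrix_algebraMap (A := A) (m := m) (1 : k)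
  map_zero' := by simpa using mkMatrix_genericMatrix_algebraMap (A := A) (m := m) (0 : k)
  map_add' a b := by
    simpa [sub_eq_zero] using (Relator.add (k := k) (m := m) a b).mkMatrix_eq_zero
  map_mul' a b := by
    simpa [sub_eq_zero] using (Relator.mul (k := k) (m := m) a b).mkMatrix_eq_zero
  commutes' := mkMatrix_genericMatrix_algebraMap

variable {B : Type*} [CommRing B] [Algebra k B]

/-- Evaluation of the indeterminates at the matrix entries of a representation. -/
noncomputable def evalEntries (ρ : A →ₐ[k] Matrix m m B) : MvPolynomial (A × m × m) k →ₐ[k] B :=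
  MvPolynomial.aeval fun x => ρ x.1 x.2.1 x.2.2

theorem mapMatrix_evalEntries_genericMatrix (ρ : A →ₐ[k] Matrix m m B) (a : A) :
    (evalEntries ρ).mapMatrix (genericMatrix k A m a) = ρ a := by
  ext i j
  simp [evalEntries, genericMatrix]

theorem Relator.mapMatrix_evalEntries_eq_zero (ρ : A →ₐ[k] Matrix m m B)
    {M : Matrix m m (MvPolynomial (A × m × m) k)} (hM : Relator k A m M) :
    (evalEntries ρ).mapMatrix M = 0 := by
  cases hM <;>
    simp only [map_sub, map_add, map_mul, mapMatrix_evalEntries_genericMatrix, AlgHom.commutes,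
      sub_self]

theorem relationIdeal_le_ker_evalEntries (ρ : A →ₐ[k] Matrix m m B) :
    relationIdeal k A m ≤ RingHom.ker (evalEntries ρ) := by
  refine Ideal.span_le.2 ?_
  rintro _ ⟨M, hM, i, j, rfl⟩
  exact congrFun₂ (hM.mapMatrix_evalEntries_eq_zero ρ) i j

/-- The homomorphism from the representation ring classifying a representation. -/
noncomputable def lift (ρ : A →ₐ[k] Matrix m m B) : RepresentationRing k A m →ₐ[k] B :=
  Ideal.Quotient.liftₐ _ (evalEntries ρ) fun _ hp => relationIdeal_le_ker_evalEntries ρ hp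

theorem mapMatrix_lift_comp_universal (ρ : A →ₐ[k] Matrix m m B) :
    (lift ρ).mapMatrix.comp (universal k A m) = ρ :=
  AlgHom.ext fun a => mapMatrix_evalEntries_genericMatrix ρ a

theorem algHom_ext {φ ψ : RepresentationRing k A m →ₐ[k] B}
    (h : φ.mapMatrix.comp (universal k A m) = ψ.mapMatrix.comp (universal k A m)) : φ = ψ := by
  refine Ideal.Quotient.algHom_ext _ (MvPolynomial.algHom_ext fun ⟨a, i, j⟩ => ?_)
  exact congrFun₂ (DFunLike.congr_fun h a) i j

theorem bijective_mapMatrix_comp_universal :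
    Function.Bijective fun φ : RepresentationRing k A m →ₐ[k] B =>
      φ.mapMatrix.comp (universal k A m) :=
  ⟨fun _ _ h => algHom_ext h, fun ρ => ⟨lift ρ, mapMatrix_lift_comp_universal ρ⟩⟩

end RepresentationRing

/-- representability of the functor `B ↦ Hom_{k-alg}(A, Mat_n(B))`:
there exist a commutative `k`-algebra `V_n(A)` and a universal representation
`π_A : A → Mat_n(V_n(A))`. -/
theorem stmt3 (k : Type u) [Field k] (A : Type u) [Ring A] [Algebra k A]
    (n : ℕ) (hn : 1 ≤ n) :
    ∃ (V : Type u) (_ : CommRing V) (_ : Algebra k V)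
      (π : A →ₐ[k] Matrix (Fin n) (Fin n) V),
      ∀ (B : Type u) (_ : CommRing B) (_ : Algebra k B),
        Function.Bijective (fun φ : V →ₐ[k] B =>
          (AlgHom.mapMatrix φ :
              Matrix (Fin n) (Fin n) V →ₐ[k] Matrix (Fin n) (Fin n) B).comp π) :=
  ⟨RepresentationRing k A (Fin n), inferInstance, inferInstance,
    RepresentationRing.universal k A (Fin n), fun _ _ _ =>
      RepresentationRing.bijective_mapMatrix_comp_universal⟩
end

section
/- Let k be a field, let Q be a finite quiver with vertex set Q₀ and arrow set Q₁, and let α : Q₀ → ℕ be a dimension vector with α_v ≥ 1 for every vertex v. Then the following are equivalent: (1) for every assignment to each arrow a : u → v of Q of matrices ρ(a) ∈ Mat_{α_v × α_u}(k) and ρ*(a) ∈ Mat_{α_u × α_v}(k), the preprojective relation Σ_{a ∈ Q₁, h(a)=v} ρ(a)ρ*(a) − Σ_{a ∈ Q₁, t(a)=v} ρ*(a)ρ(a) = 0 holds at every vertex v; (2) every arrow a of Q is a loop (h(a) = t(a)) based at a vertex v with α_v = 1. Equivalently, the α-dimensional representation variety of the preprojective algebra Π(Q) coincides with the representation space of the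 double quiver of Q exactly for such quivers, which is the condition that the zero representation of Π(Q) is a smooth point. -/
/-- Products of `1 × 1` matrices commute, entrywise and for sizes only propositionally `1`. -/
theorem Matrix.mul_apply_eq_mul_apply_of_eq_one {R : Type*} [CommSemiring R] {m n : ℕ}
    (hm : m = 1) (hn : n = 1) (A : Matrix (Fin m) (Fin n) R) (B : Matrix (Fin n) (Fin m) R)
    (i j : Fin m) (i' j' : Fin n) : (A * B) i j = (B * A) i' j' := by
  subst hm hn
  rw [Subsingleton.elim i 0, Subsingleton.elim j 0, Subsingleton.elim i' 0,
    Subsingleton.elim j' 0]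
  simp [Matrix.mul_apply, mul_comm]


/-- for a finite quiver (vertex set `Q₀`, arrow set `Q₁`, head `h`, tail `t`)
with a sincere dimension vector `α`, the preprojective relation holds identically on the
whole representation space of the double quiver iff every arrow is a loop at a vertex of
dimension `1` (i.e. the zero representation of the preprojective algebra is a smooth
point). -/
theorem stmt7 (k : Type*) [Field k]
    (Q₀ Q₁ : Type*) [Fintype Q₀] [Fintype Q₁] [DecidableEq Q₀]
    (h t : Q₁ → Q₀) (α : Q₀ → ℕ) (hα : ∀ v, 1 ≤ α v) :
    (∀ (ρ : ∀ a : Q₁, Matrix (Fin (α (h a))) (Fin (α (t a))) k)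
       (σ : ∀ a : Q₁, Matrix (Fin (α (t a))) (Fin (α (h a))) k) (v : Q₀),
       (∑ a : Q₁, if hav : h a = v then
           (Matrix.reindex (finCongr (congrArg α hav)) (finCongr (congrArg α hav))
             (ρ a * σ a) : Matrix (Fin (α v)) (Fin (α v)) k) else 0) -
       (∑ a : Q₁, if hta : t a = v then
           (Matrix.reindex (finCongr (congrArg α hta)) (finCongr (congrArg α hta))
             (σ a * ρ a) : Matrix (Fin (α v)) (Fin (α v)) k) else 0) = 0) ↔
      ∀ a : Q₁, h a = t a ∧ α (h a) = 1 := by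
  classical
  constructor
  · intro H b
    have key : ∀ (R : Matrix (Fin (α (h b))) (Fin (α (t b))) k)
        (S : Matrix (Fin (α (t b))) (Fin (α (h b))) k),
        R * S - (if hta : t b = h b then
          (Matrix.reindex (finCongr (congrArg α hta)) (finCongr (congrArg α hta))
            (S * R) : Matrix (Fin (α (h b))) (Fin (α (h b))) k) else 0) = 0 := by
      intro R S
      have hb := H (Pi.single b R) (Pi.single b S) (h b)
      rw [Finset.sum_eq_single b, Finset.sum_eq_single b] at hb
      · simpa using hb
      · intro a _ hab
        simp [Pi.single_eq_of_ne hab]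
      · simp
      · intro a _ hab
        simp [Pi.single_eq_of_ne hab]
      · simp
    let x : Fin (α (h b)) := ⟨0, hα _⟩
    let y : Fin (α (t b)) := ⟨0, hα _⟩
    have hloop : h b = t b := by
      by_contra hne
      have hxx := key (Matrix.single x y 1) (Matrix.single y x 1)
      rw [dif_neg (Ne.symm hne), sub_zero, Matrix.single_mul_single_same] at hxx
      simpa using congrFun (congrFun hxx x) x
    refine ⟨hloop, ?_⟩
    by_contra hone
    let z : Fin (α (h b)) := ⟨1, lt_of_le_of_ne (hα _) (Ne.symm hone)⟩
    have hzx : z ≠ x := by simp [z, x]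
    have hxz := key (Matrix.single x y 1) (Matrix.single y z 1)
    rw [dif_pos hloop.symm, Matrix.single_mul_single_same,
      Matrix.single_mul_single_of_ne _ _ _ _ hzx] at hxz
    simpa using congrFun (congrFun hxz x) z
  · intro H ρ σ v
    rw [sub_eq_zero]
    refine Finset.sum_congr rfl fun a _ => ?_
    obtain ⟨hloop, hone⟩ := H a
    by_cases hav : h a = v
    · rw [dif_pos hav, dif_pos (hloop.symm.trans hav)]
      ext i j
      exact Matrix.mul_apply_eq_mul_apply_of_eq_one hone (hloop ▸ hone) _ _ _ _ _ _
    · rw [dif_neg hav, dif_neg (hloop ▸ hav)]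
end

section
/- Let g > 1 and let A_g be the group algebra over ℂ of the surface group of genus g. Then for every integer n ≥ 1 there exists a simple left A_g-module of dimension n over ℂ; equivalently, the surface group of genus g > 1 admits an irreducible n-dimensional complex representation for every n ≥ 1. -/
/-- The single surface relator `X₁Y₁X₁⁻¹Y₁⁻¹ ⋯ X_gY_gX_g⁻¹Y_g⁻¹` in the free group on
generators `Xᵢ = (i, true)` and `Yᵢ = (i, false)`, `i : Fin g`. -/
def surfaceRelator (g : ℕ) : FreeGroup (Fin g × Bool) :=
  (List.ofFn fun i : Fin g =>
    FreeGroup.of (i, true) * FreeGroup.of (i, false) *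
      (FreeGroup.of (i, true))⁻¹ * (FreeGroup.of (i, false))⁻¹).prod

/-- The fundamental group of a compact orientable surface of genus `g`. -/
abbrev surfaceGroup (g : ℕ) : Type :=
  PresentedGroup ({surfaceRelator g} : Set (FreeGroup (Fin g × Bool)))

/-- The surface group surjects onto every group generated by two elements `a`, `b`: all `Yᵢ` go
to `1`, `X₁` to `a` and the other `Xᵢ` to `b`. -/
theorem exists_hom_surfaceGroup {G : Type*} [Group G] {g : ℕ} (hg : 1 < g) (a b : G) :
    ∃ φ : surfaceGroup g →* G, ∃ x y : surfaceGroup g, φ x = a ∧ φ y = b := by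
  let f : Fin g × Bool → G := fun p =>
    if p.2 then (if p.1 = ⟨0, by omega⟩ then a else b) else 1
  have hf : ∀ r ∈ ({surfaceRelator g} : Set (FreeGroup (Fin g × Bool))),
      FreeGroup.lift f r = 1 := by
    rintro r rfl
    rw [surfaceRelator, map_list_prod]
    apply List.prod_eq_one
    intro x hx
    rw [List.map_ofFn, List.mem_ofFn] at hx
    obtain ⟨i, rfl⟩ := hx
    simp [f]
  refine ⟨PresentedGroup.toGroup hf, PresentedGroup.of (⟨0, by omega⟩, true),
    PresentedGroup.of (⟨1, hg⟩, true), ?_, ?_⟩ <;> simp [f]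

/-- The reflection of `ZMod n → ℂ` changing the sign of the coordinate at `0`. -/
def reflectZero (n : ℕ) : (ZMod n → ℂ) ≃ₗ[ℂ] (ZMod n → ℂ) :=
  LinearEquiv.ofInvolutive
    { toFun := fun v j => if j = 0 then -v j else v j
      map_add' := fun v w => by
        ext j
        by_cases h : j = 0
        · simp only [h, if_true, Pi.add_apply]; ring
        · simp [h]
      map_smul' := fun c v => by
        ext j
        by_cases h : j = 0 <;> simp [h] }
    (fun v => by
      ext j
      by_cases h : j = 0 <;> simp [h])

/-- The cyclic shift of coordinates on `ZMod n → ℂ`. -/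
def cyclicShift (n : ℕ) : (ZMod n → ℂ) ≃ₗ[ℂ] (ZMod n → ℂ) :=
  LinearEquiv.funCongrLeft ℂ ℂ (Equiv.addRight 1)

theorem reflectZero_apply (n : ℕ) (v : ZMod n → ℂ) (j : ZMod n) :
    reflectZero n v j = if j = 0 then -v j else v j := rfl

theorem cyclicShift_apply (n : ℕ) (v : ZMod n → ℂ) (j : ZMod n) :
    cyclicShift n v j = v (j + 1) := rfl

theorem cyclicShift_pow_apply (n k : ℕ) (v : ZMod n → ℂ) (j : ZMod n) :
    (cyclicShift n ^ k) v j = v (j + k) := by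
  induction k generalizing v with
  | zero => simp
  | succ k ih =>
    rw [pow_succ, LinearEquiv.mul_apply, ih, cyclicShift_apply]
    push_cast
    rw [add_assoc]

/-- A nonzero subspace stable under `reflectZero` and `cyclicShift` is everything. -/
theorem eq_top_of_reflectZero_cyclicShift_stable {n : ℕ} [NeZero n]
    (N : Submodule ℂ (ZMod n → ℂ)) (hA : ∀ v ∈ N, reflectZero n v ∈ N)
    (hB : ∀ v ∈ N, cyclicShift n v ∈ N) (hN : N ≠ ⊥) : N = ⊤ := by
  have hBk : ∀ k : ℕ, ∀ v ∈ N, (cyclicShift n ^ k) v ∈ N := by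
    intro k
    induction k with
    | zero => intro v hv; simpa using hv
    | succ k ih => intro v hv; rw [pow_succ, LinearEquiv.mul_apply]; exact ih _ (hB v hv)
  obtain ⟨v, hv, hv0⟩ := N.exists_mem_ne_zero_of_ne_bot hN
  obtain ⟨i, hi⟩ := Function.ne_iff.mp hv0
  have hw := hBk i.val v hv
  set w := (cyclicShift n ^ i.val) v with hwdef
  have hw0 : w 0 = v i := by rw [hwdef, cyclicShift_pow_apply]; simp
  have hw0' : w 0 ≠ 0 := by rw [hw0]; exact hi
  have he : (Pi.single 0 1 : ZMod n → ℂ) ∈ N := by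
    have h := N.smul_mem (2 * w 0)⁻¹ (N.sub_mem hw (hA w hw))
    convert h using 1
    ext j
    by_cases hj : j = 0
    · subst hj
      simp only [Pi.single_eq_same, Pi.smul_apply, Pi.sub_apply, reflectZero_apply, if_true,
        smul_eq_mul]
      field_simp
      ring
    · simp [hj, reflectZero_apply]
  have hsingle : ∀ j : ZMod n, (Pi.single j 1 : ZMod n → ℂ) ∈ N := by
    intro j
    convert hBk (-j).val _ he using 1
    ext l
    rw [cyclicShift_pow_apply, Pi.single_apply, Pi.single_apply, ZMod.natCast_zmod_val]
    simp only [← sub_eq_add_neg, sub_eq_zero]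
  rw [eq_top_iff]
  intro u _
  rw [pi_eq_sum_univ' u]
  refine N.sum_mem fun j _ => N.smul_mem _ ?_
  convert hsingle j using 1

/-- for `g > 1` and every `n ≥ 1` the group algebra `A_g = ℂ[π₁(S_g)]`
has a simple left module of complex dimension `n`. -/
theorem stmt9 (g : ℕ) (hg : 1 < g) (n : ℕ) (hn : 1 ≤ n) :
    ∃ (M : Type) (_ : AddCommGroup M)
      (_ : Module (MonoidAlgebra ℂ (surfaceGroup g)) M) (_ : Module ℂ M)
      (_ : IsScalarTower ℂ (MonoidAlgebra ℂ (surfaceGroup g)) M),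
      IsSimpleModule (MonoidAlgebra ℂ (surfaceGroup g)) M ∧ Module.finrank ℂ M = n := by
  have : NeZero n := ⟨by omega⟩
  obtain ⟨φ, x, y, hx, hy⟩ := exists_hom_surfaceGroup hg (reflectZero n) (cyclicShift n)
  let ψ : surfaceGroup g →* Module.End ℂ (ZMod n → ℂ) :=
    (LinearEquiv.automorphismGroup.toLinearMapMonoidHom).comp φ
  let F := MonoidAlgebra.lift ℂ (Module.End ℂ (ZMod n → ℂ)) (surfaceGroup g) ψ
  let inst : Module (MonoidAlgebra ℂ (surfaceGroup g)) (ZMod n → ℂ) :=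
    Module.compHom _ F.toRingHom
  have hsmul : ∀ (a : MonoidAlgebra ℂ (surfaceGroup g)) (v : ZMod n → ℂ), a • v = F a v :=
    fun _ _ => rfl
  have hof : ∀ (z : surfaceGroup g) (v : ZMod n → ℂ),
      MonoidAlgebra.of ℂ (surfaceGroup g) z • v = φ z v := fun z v => by
    rw [hsmul, MonoidAlgebra.lift_of]
    rfl
  have htower : IsScalarTower ℂ (MonoidAlgebra ℂ (surfaceGroup g)) (ZMod n → ℂ) :=
    ⟨fun c a v => by rw [hsmul, hsmul, map_smul, LinearMap.smul_apply]⟩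
  refine ⟨ZMod n → ℂ, inferInstance, inst, inferInstance, htower, ?_, ?_⟩
  · rw [isSimpleModule_iff]
    refine { exists_pair_ne := ⟨⊥, ⊤, bot_ne_top⟩, eq_bot_or_eq_top := fun N => ?_ }
    refine or_iff_not_imp_left.mpr fun hN => ?_
    rw [← Submodule.restrictScalars_eq_top_iff (S := ℂ)]
    refine eq_top_of_reflectZero_cyclicShift_stable _ (fun v hv => ?_) (fun v hv => ?_) ?_
    · rw [← hx, ← hof]
      exact N.smul_mem _ hv
    · rw [← hy, ← hof]
      exact N.smul_mem _ hv
    · rwa [Ne, Submodule.restrictScalars_eq_bot_iff]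
  · rw [Module.finrank_fintype_fun_eq_card, ZMod.card]
end
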